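/- Let A be a real m×n matrix, b ∈ ℝ^m, B a real s×n matrix, d ∈ ℝ^s, λ > 0, and f(x) = (1/2)‖Ax − b‖² + λ‖x‖₁. Suppose (x̄, v̄) ∈ ℝⁿ × ℝ^s satisfies the KKT conditions: Bx̄ = d and Bᵀv̄ − Aᵀ(Ax̄ − b) ∈ λ·∂‖·‖₁(x̄). Then the set S of minimizers of f over C = {x : Bx = d} admits the representation S = D₁ ∩ D₂ ∩ D₃, where D₁ = {x ∈ ℝⁿ : Ax = Ax̄}, D₂ = {x ∈ ℝⁿ : Bx = d}, and D₃ = {x ∈ ℝⁿ : Bᵀv̄ − Aᵀ(Ax̄ − b) ∈ λ·∂‖·‖₁(x)}. -/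

import Mathlib

open Matrix

/-- Euclidean norm on `Fin n → ℝ`. -/
noncomputable def euclNorm {n : ℕ} (x : Fin n → ℝ) : ℝ := Real.sqrt (∑ i, x i ^ 2)

/-- Euclidean inner product on `Fin n → ℝ`. -/
def dotp {n : ℕ} (x y : Fin n → ℝ) : ℝ := ∑ i, x i * y i

/-- ℓ₁ norm on `Fin n → ℝ`. -/
def l1norm {n : ℕ} (x : Fin n → ℝ) : ℝ := ∑ i, |x i|

/-- Euclidean distance from a point to a set: `inf_{y ∈ S} ‖x − y‖`. -/
noncomputable def distSet {n : ℕ} (x : Fin n → ℝ) (S : Set (Fin n → ℝ)) : ℝ :=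
  sInf ((fun y => euclNorm (x - y)) '' S)

/-- Subdifferential of a (convex) function `g` at `x`. -/
def subdiff {n : ℕ} (g : (Fin n → ℝ) → ℝ) (x : Fin n → ℝ) : Set (Fin n → ℝ) :=
  {s : Fin n → ℝ | ∀ y, g y ≥ g x + dotp s (y - x)}

theorem dotp_eq_dotProduct {n : ℕ} (x y : Fin n → ℝ) : dotp x y = x ⬝ᵥ y := rfl

theorem euclNorm_sq {n : ℕ} (x : Fin n → ℝ) : euclNorm x ^ 2 = x ⬝ᵥ x := by
  rw [euclNorm, Real.sq_sqrt (Finset.sum_nonneg fun i _ => sq_nonneg (x i))]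
  simp only [dotProduct, sq]

/-- If equality holds in the subgradient inequality between `x` and `y`, then a subgradient
at `x` is also a subgradient at `y`. -/
theorem mem_subdiff_of_eq {n : ℕ} {h : (Fin n → ℝ) → ℝ} {x y g : Fin n → ℝ}
    (hg : g ∈ subdiff h x) (hxy : h y = h x + dotp g (y - x)) : g ∈ subdiff h y := by
  intro z
  have hz := hg z
  simp only [dotp_eq_dotProduct, dotProduct_sub] at hxy hz ⊢
  linarith

/-- The exact excess of the Lasso objective over its value at a point satisfying the
stationarity condition. -/
theorem lasso_sub_eq_of_stationary {m n s : ℕ} {A : Matrix (Fin m) (Fin n) ℝ} {b : Fin m → ℝ}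
    {B : Matrix (Fin s) (Fin n) ℝ} {lam : ℝ} {x y g : Fin n → ℝ} {v : Fin s → ℝ}
    (hB : B *ᵥ y = B *ᵥ x) (hg : Bᵀ *ᵥ v - Aᵀ *ᵥ (A *ᵥ x - b) = lam • g) :
    ((1 / 2) * euclNorm (A *ᵥ y - b) ^ 2 + lam * l1norm y) -
        ((1 / 2) * euclNorm (A *ᵥ x - b) ^ 2 + lam * l1norm x) =
      (1 / 2) * euclNorm (A *ᵥ y - A *ᵥ x) ^ 2 +
        lam * (l1norm y - (l1norm x + dotp g (y - x))) := by
  have key : lam * (g ⬝ᵥ (y - x)) = -((A *ᵥ x - b) ⬝ᵥ (A *ᵥ y - A *ᵥ x)) := by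
    rw [← smul_eq_mul, ← smul_dotProduct, ← hg, sub_dotProduct, mulVec_transpose,
      mulVec_transpose, ← dotProduct_mulVec, ← dotProduct_mulVec, mulVec_sub, mulVec_sub, hB,
      sub_self, dotProduct_zero, zero_sub]
  simp only [euclNorm_sq, dotp_eq_dotProduct, mul_sub, mul_add, key]
  simp only [sub_dotProduct, dotProduct_sub, dotProduct_comm b,
    dotProduct_comm (A *ᵥ y) (A *ᵥ x)]
  ring

/-- **Representation of the constrained Lasso solution set** (Proposition 3):
if `(x̄, v̄)` satisfies the KKT conditions `Bx̄ = d` and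
`Bᵀv̄ − Aᵀ(Ax̄ − b) ∈ λ∂‖·‖₁(x̄)`, then the solution set `S` of
`min (1/2)‖Ax−b‖² + λ‖x‖₁ s.t. Bx = d` equals `D₁ ∩ D₂ ∩ D₃` where
`D₁ = {x : Ax = Ax̄}`, `D₂ = {x : Bx = d}`,
`D₃ = {x : Bᵀv̄ − Aᵀ(Ax̄ − b) ∈ λ∂‖·‖₁(x)}`. -/
theorem constrained_lasso_solution_set_representation
    {m n s : ℕ} (A : Matrix (Fin m) (Fin n) ℝ) (b : Fin m → ℝ)
    (B : Matrix (Fin s) (Fin n) ℝ) (d : Fin s → ℝ)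
    (lam : ℝ) (hlam : 0 < lam)
    (f : (Fin n → ℝ) → ℝ)
    (hf : f = fun x => (1 / 2) * euclNorm (A *ᵥ x - b) ^ 2 + lam * l1norm x)
    (S : Set (Fin n → ℝ))
    (hS : S = {x | B *ᵥ x = d ∧ ∀ y, B *ᵥ y = d → f x ≤ f y})
    (xbar : Fin n → ℝ) (vbar : Fin s → ℝ)
    (hfeas : B *ᵥ xbar = d)
    (hkkt : ∃ g ∈ subdiff l1norm xbar,
      Bᵀ *ᵥ vbar - Aᵀ *ᵥ (A *ᵥ xbar - b) = lam • g) :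
    S = {x | A *ᵥ x = A *ᵥ xbar} ∩ {x | B *ᵥ x = d} ∩
        {x | ∃ g ∈ subdiff l1norm x,
          Bᵀ *ᵥ vbar - Aᵀ *ᵥ (A *ᵥ xbar - b) = lam • g} := by
  have hfg (x y g : Fin n → ℝ) (hB : B *ᵥ y = B *ᵥ x)
      (hg : Bᵀ *ᵥ vbar - Aᵀ *ᵥ (A *ᵥ x - b) = lam • g) :
      f y - f x = (1 / 2) * euclNorm (A *ᵥ y - A *ᵥ x) ^ 2 +
        lam * (l1norm y - (l1norm x + dotp g (y - x))) := by
    rw [hf]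
    exact lasso_sub_eq_of_stationary hB hg
  subst hS
  ext x
  constructor
  · rintro ⟨hx, hmin⟩
    obtain ⟨g, hg, hgeq⟩ := hkkt
    have hexcess := hfg xbar x g (hx.trans hfeas.symm) hgeq
    have hle := hmin xbar hfeas
    have hgap : 0 ≤ l1norm x - (l1norm xbar + dotp g (x - xbar)) := sub_nonneg.2 (hg x)
    have hlamgap := mul_nonneg hlam.le hgap
    have hsq := sq_nonneg (euclNorm (A *ᵥ x - A *ᵥ xbar))
    refine ⟨⟨?_, hx⟩, g, mem_subdiff_of_eq hg ?_, hgeq⟩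
    · have hzero : euclNorm (A *ᵥ x - A *ᵥ xbar) ^ 2 = 0 := by linarith
      rw [euclNorm_sq, dotProduct_self_eq_zero] at hzero
      exact sub_eq_zero.1 hzero
    · have hzero : lam * (l1norm x - (l1norm xbar + dotp g (x - xbar))) = 0 := by linarith
      exact sub_eq_zero.1 ((mul_eq_zero.1 hzero).resolve_left hlam.ne')
  · rintro ⟨⟨hA, hx⟩, g, hg, hgeq⟩
    refine ⟨hx, fun y hy => ?_⟩
    rw [← show A *ᵥ x = A *ᵥ xbar from hA] at hgeq
    have hexcess := hfg x y g (hy.trans hx.symm) hgeq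
    have hlamgap := mul_nonneg hlam.le (sub_nonneg.2 (hg y))
    have hsq := sq_nonneg (euclNorm (A *ᵥ y - A *ᵥ x))
    linarith
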